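/- Let A be a Banach algebra in the wsaBAI class and let J be a closed ideal of A. If J is a weak Riesz ideal, then J is a small-1-1 ideal. -/

import Mathlib

noncomputable section

open Filter Topology

section ArensSetup

variable (A : Type*) [NonUnitalNormedRing A] [NormedSpace ℂ A]
  [IsScalarTower ℂ A A] [SMulCommClass ℂ A A]

/-- The module action `φ · a` of `A` on `A*`: `⟨φ · a, b⟩ = ⟨φ, a * b⟩`. -/
def dArR (φ : A →L[ℂ] ℂ) (a : A) : A →L[ℂ] ℂ :=
  φ.comp (ContinuousLinearMap.mul ℂ A a)

/-- The module action `a · φ` of `A` on `A*`: `⟨a · φ, b⟩ = ⟨φ, b * a⟩`. -/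
def dArL (a : A) (φ : A →L[ℂ] ℂ) : A →L[ℂ] ℂ :=
  φ.comp ((ContinuousLinearMap.mul ℂ A).flip a)

/-- `φ ↦ (a ↦ φ · a)`, bundled as a continuous linear map. -/
def dArRL : (A →L[ℂ] ℂ) →L[ℂ] A →L[ℂ] A →L[ℂ] ℂ :=
  ((ContinuousLinearMap.compL ℂ A (A →L[ℂ] A) (A →L[ℂ] ℂ)).flip
      (ContinuousLinearMap.mul ℂ A)).comp (ContinuousLinearMap.compL ℂ A A ℂ)

/-- `φ ↦ (a ↦ a · φ)`, bundled as a continuous linear map. -/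
def dArLL : (A →L[ℂ] ℂ) →L[ℂ] A →L[ℂ] A →L[ℂ] ℂ :=
  ((ContinuousLinearMap.compL ℂ A (A →L[ℂ] A) (A →L[ℂ] ℂ)).flip
      ((ContinuousLinearMap.mul ℂ A).flip)).comp (ContinuousLinearMap.compL ℂ A A ℂ)

/-- The module action `m · φ` of `A**` on `A*`: `⟨m · φ, a⟩ = ⟨m, φ · a⟩`. -/
def bdF (m : (A →L[ℂ] ℂ) →L[ℂ] ℂ) (φ : A →L[ℂ] ℂ) : A →L[ℂ] ℂ :=
  m.comp (dArRL A φ)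

/-- The module action `φ · m` of `A**` on `A*`: `⟨φ · m, a⟩ = ⟨m, a · φ⟩`. -/
def fBd (φ : A →L[ℂ] ℂ) (m : (A →L[ℂ] ℂ) →L[ℂ] ℂ) : A →L[ℂ] ℂ :=
  m.comp (dArLL A φ)

/-- The first Arens product on `A**`: `⟨m n, φ⟩ = ⟨m, n · φ⟩`. -/
def ar1 (m n : (A →L[ℂ] ℂ) →L[ℂ] ℂ) : (A →L[ℂ] ℂ) →L[ℂ] ℂ :=
  m.comp ((ContinuousLinearMap.compL ℂ A (A →L[ℂ] ℂ) ℂ n).comp (dArRL A))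

/-- The second Arens product on `A**`: `⟨m ◊ n, φ⟩ = ⟨n, φ · m⟩`. -/
def ar2 (m n : (A →L[ℂ] ℂ) →L[ℂ] ℂ) : (A →L[ℂ] ℂ) →L[ℂ] ℂ :=
  n.comp ((ContinuousLinearMap.compL ℂ A (A →L[ℂ] ℂ) ℂ m).comp (dArLL A))

/-- The canonical embedding of `A` into its bidual. -/
def ιA : A →L[ℂ] ((A →L[ℂ] ℂ) →L[ℂ] ℂ) := ContinuousLinearMap.apply ℂ ℂ

/-- The set of weakly almost periodic functionals: those `φ ∈ A*` for which `a ↦ a · φ`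
is a weakly compact operator from `A` to `A*`. -/
def WAPset : Set (A →L[ℂ] ℂ) :=
  {φ | IsCompact (closure
    ((fun a : A => (show WeakSpace ℂ (A →L[ℂ] ℂ) from dArL A a φ)) '' Metric.closedBall 0 1))}

/-- `u` is a bounded (two-sided) approximate identity along the filter `l`. -/
def IsBAIFor {ιt : Type*} (l : Filter ιt) (u : ιt → A) : Prop :=
  l.NeBot ∧ Bornology.IsBounded (Set.range u) ∧
    (∀ a : A, Tendsto (fun i => a * u i) l (𝓝 a)) ∧
    (∀ a : A, Tendsto (fun i => u i * a) l (𝓝 a))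

/-- `A` has a bounded approximate identity. -/
def HasBAI : Prop := ∃ (ιt : Type) (l : Filter ιt) (u : ιt → A), IsBAIFor A l u

/-- A mixed identity of `A**`: a right identity for the first Arens product and a left
identity for the second Arens product. -/
def IsMixedIdentity (e : (A →L[ℂ] ℂ) →L[ℂ] ℂ) : Prop :=
  (∀ m, ar1 A m e = m) ∧ (∀ m, ar2 A e m = m)

/-- `A` is a two-sided ideal in its bidual (with the first Arens product). -/
def IdealInBidual : Prop :=
  ∀ (m : (A →L[ℂ] ℂ) →L[ℂ] ℂ) (a : A),
    ar1 A m (ιA A a) ∈ Set.range (ιA A) ∧ ar1 A (ιA A a) m ∈ Set.range (ιA A)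

/-- `A` is weakly sequentially complete. -/
def WeaklySequentiallyComplete : Prop :=
  ∀ x : ℕ → A, (∀ φ : A →L[ℂ] ℂ, ∃ z : ℂ, Tendsto (fun n => φ (x n)) atTop (𝓝 z)) →
    ∃ a : A, ∀ φ : A →L[ℂ] ℂ, Tendsto (fun n => φ (x n)) atTop (𝓝 (φ a))

/-- The wsaBAI class: weakly sequentially complete, with a bounded approximate identity,
and an ideal in its bidual. -/
def IsWSABAI : Prop :=
  WeaklySequentiallyComplete A ∧ HasBAI A ∧ IdealInBidual A

/-- `J` is a closed two-sided ideal of `A`. -/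
def IsClosedIdeal (J : Submodule ℂ A) : Prop :=
  IsClosed (J : Set A) ∧ (∀ b : A, ∀ a ∈ J, b * a ∈ J) ∧ (∀ b : A, ∀ a ∈ J, a * b ∈ J)

/-- The canonical image `J^{⊥⊥}` of `J**` inside `A**`.  For a closed ideal `J` this
realizes the bidual of `J` (with its Arens products) inside `A**`. -/
def bidualOf (J : Submodule ℂ A) : Set ((A →L[ℂ] ℂ) →L[ℂ] ℂ) :=
  {s | ∀ φ : A →L[ℂ] ℂ, (∀ a ∈ J, φ a = 0) → s φ = 0}

/-- The first topological centre of a subset of `A**` (e.g. of `J** = bidualOf A J`). -/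
def Z1in (S : Set ((A →L[ℂ] ℂ) →L[ℂ] ℂ)) : Set ((A →L[ℂ] ℂ) →L[ℂ] ℂ) :=
  {m ∈ S | ∀ n ∈ S, ar1 A m n = ar2 A m n}

/-- The second topological centre of a subset of `A**`. -/
def Z2in (S : Set ((A →L[ℂ] ℂ) →L[ℂ] ℂ)) : Set ((A →L[ℂ] ℂ) →L[ℂ] ℂ) :=
  {m ∈ S | ∀ n ∈ S, ar1 A n m = ar2 A n m}

/-- The restriction map `i* : A* → J*` adjoint to the inclusion `i : J → A`. -/
def iStar (J : Submodule ℂ A) : (A →L[ℂ] ℂ) →L[ℂ] (↥J →L[ℂ] ℂ) :=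
  (ContinuousLinearMap.compL ℂ ↥J A ℂ).flip J.subtypeL

/-- `i*(WAP(A))^⊥ = {r ∈ J** : ⟨r, i*(φ)⟩ = 0 for all φ ∈ WAP(A)}`, realized inside `A**`. -/
def wapPerp (J : Submodule ℂ A) : Set ((A →L[ℂ] ℂ) →L[ℂ] ℂ) :=
  {r ∈ bidualOf A J | ∀ φ ∈ WAPset A, r φ = 0}

/-- `J` is a weak Riesz ideal: `J** · J* ∪ J* · J**` is contained in the norm closure
of `i*(WAP(A))` in `J*`. -/
def WeakRiesz (J : Submodule ℂ A) : Prop :=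
  ∀ m ∈ bidualOf A J, ∀ ψ : A →L[ℂ] ℂ,
    iStar A J (bdF A m ψ) ∈ closure (iStar A J '' WAPset A) ∧
    iStar A J (fBd A ψ m) ∈ closure (iStar A J '' WAPset A)

/-- `J` is a small-1-1 ideal: `e J** J** ⊆ J`. -/
def Small11 (J : Submodule ℂ A) (e : (A →L[ℂ] ℂ) →L[ℂ] ℂ) : Prop :=
  ∀ m ∈ bidualOf A J, ∀ n ∈ bidualOf A J,
    ar1 A e (ar1 A m n) ∈ ιA A '' (J : Set A)

/-- `J` is a Riesz ideal: `e J** = J** ◊ e = J`. -/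
def RieszIdeal (J : Submodule ℂ A) (e : (A →L[ℂ] ℂ) →L[ℂ] ℂ) : Prop :=
  {s | ∃ m ∈ bidualOf A J, s = ar1 A e m} = ιA A '' (J : Set A) ∧
  {s | ∃ m ∈ bidualOf A J, s = ar2 A m e} = ιA A '' (J : Set A)

/-- `J` has a bounded approximate identity (as a Banach algebra in its own right). -/
def HasBAIinIdeal (J : Submodule ℂ A) : Prop :=
  ∃ (ιt : Type) (l : Filter ιt) (u : ιt → A), l.NeBot ∧ Bornology.IsBounded (Set.range u) ∧
    (∀ i, u i ∈ J) ∧ (∀ a ∈ J, Tendsto (fun i => a * u i) l (𝓝 a)) ∧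
    (∀ a ∈ J, Tendsto (fun i => u i * a) l (𝓝 a))

/-- `WAP(J)` as a subset of `J*`: those `ξ ∈ J*` such that `b ↦ b · ξ` is a weakly
compact operator from `J` to `J*`.  The action is computed through any Hahn–Banach
extension `ψ ∈ A*` of `ξ` (for an ideal `J` the result does not depend on the extension). -/
def WAPJ (J : Submodule ℂ A) : Set (↥J →L[ℂ] ℂ) :=
  {ξ | ∃ ψ : A →L[ℂ] ℂ, iStar A J ψ = ξ ∧
    IsCompact (closure
      ((fun b : ↥J => (show WeakSpace ℂ (↥J →L[ℂ] ℂ) from iStar A J (dArL A (b : A) ψ))) ''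
        Metric.closedBall 0 1))}

end ArensSetup

section WeakRieszSmall

set_option linter.unusedSectionVars false

variable {A : Type*} [NonUnitalNormedRing A] [NormedSpace ℂ A]
  [IsScalarTower ℂ A A] [SMulCommClass ℂ A A]

lemma ar1_apply (m n : (A →L[ℂ] ℂ) →L[ℂ] ℂ) (φ : A →L[ℂ] ℂ) :
    ar1 A m n φ = m (bdF A n φ) := rfl

lemma ιA_apply (a : A) (φ : A →L[ℂ] ℂ) : ιA A a φ = φ a := rfl

lemma bdF_apply (m : (A →L[ℂ] ℂ) →L[ℂ] ℂ) (φ : A →L[ℂ] ℂ) (a : A) :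
    bdF A m φ a = m (dArR A φ a) := rfl

lemma dArL_apply (a : A) (φ : A →L[ℂ] ℂ) (b : A) : dArL A a φ b = φ (b * a) := rfl

lemma dArR_apply (φ : A →L[ℂ] ℂ) (a b : A) : dArR A φ a b = φ (a * b) := rfl

lemma norm_ιA (a : A) : ‖ιA A a‖ = ‖a‖ :=
  (NormedSpace.inclusionInDoubleDualLi ℂ).norm_map a

/-- The first Arens product of anything with an element of `J**` lies in `J**`. -/
lemma ar1_mem_bidualOf {J : Submodule ℂ A} (hJ : IsClosedIdeal A J)
    (m : (A →L[ℂ] ℂ) →L[ℂ] ℂ) {n : (A →L[ℂ] ℂ) →L[ℂ] ℂ} (hn : n ∈ bidualOf A J) :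
    ar1 A m n ∈ bidualOf A J := by
  intro φ hφ
  have : bdF A n φ = 0 := by
    ext a
    exact hn _ fun b hb => hφ _ (hJ.2.1 a b hb)
  rw [ar1_apply, this, map_zero]

/-- `A ∩ J** = J`. -/
lemma mem_of_ιA_mem_bidualOf {J : Submodule ℂ A} (hJ : IsClosed (J : Set A)) {a : A}
    (ha : ιA A a ∈ bidualOf A J) : a ∈ J := by
  by_contra haJ
  have : IsClosed (J : Set A) := hJ
  have hq : J.mkQ a ≠ 0 := by simpa using haJ
  obtain ⟨f, hf⟩ := SeparatingDual.exists_ne_zero (R := ℂ) hq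
  exact hf (ha (f.comp J.mkQL) fun b hb => by
    simp [(Submodule.Quotient.mk_eq_zero J).2 hb])

/-- Functionals in `J**` only see restrictions to `J`. -/
lemma norm_apply_le_of_mem_bidualOf {J : Submodule ℂ A} {s : (A →L[ℂ] ℂ) →L[ℂ] ℂ}
    (hs : s ∈ bidualOf A J) (χ : A →L[ℂ] ℂ) : ‖s χ‖ ≤ ‖s‖ * ‖iStar A J χ‖ := by
  obtain ⟨g, hg, hgn⟩ := exists_extension_norm_eq J (iStar A J χ)
  have h0 : s (χ - g) = 0 := hs _ fun a ha => by
    rw [sub_apply, hg ⟨a, ha⟩]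
    exact sub_self _
  rw [map_sub, sub_eq_zero] at h0
  rw [h0, ← hgn]
  exact s.le_opNorm g

/-- An element of `i*(WAP(A))^⊥` kills everything whose restriction to `J` is in the closure
of `i*(WAP(A))`. -/
lemma apply_eq_zero_of_mem_wapPerp {J : Submodule ℂ A} {s : (A →L[ℂ] ℂ) →L[ℂ] ℂ}
    (hs : s ∈ wapPerp A J) {χ : A →L[ℂ] ℂ}
    (hχ : iStar A J χ ∈ closure (iStar A J '' WAPset A)) : s χ = 0 := by
  have key : ∀ ε > 0, ‖s χ‖ ≤ ‖s‖ * ε := by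
    intro ε hε
    obtain ⟨_, ⟨φ, hφ, rfl⟩, hd⟩ :=
      (SeminormedAddCommGroup.mem_closure_iff (E := J →L[ℂ] ℂ)).1 hχ ε hε
    have h1 : s χ = s (χ - φ) := by rw [map_sub, hs.2 φ hφ, sub_zero]
    rw [h1]
    refine (norm_apply_le_of_mem_bidualOf hs.1 _).trans ?_
    rw [map_sub]
    exact mul_le_mul_of_nonneg_left hd.le (norm_nonneg s)
  have hlim : Tendsto (fun ε : ℝ => ‖s‖ * ε) (𝓝[>] 0) (𝓝 0) := by
    have : Tendsto (fun ε : ℝ => ‖s‖ * ε) (𝓝 0) (𝓝 (‖s‖ * 0)) := tendsto_id.const_mul _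
    rw [mul_zero] at this
    exact this.mono_left nhdsWithin_le_nhds
  exact norm_le_zero_iff.1 (ge_of_tendsto hlim (eventually_mem_nhdsWithin.mono key))

/-- Bounded families in `A` have weak*-limits in `A**` along ultrafilters. -/
lemma exists_weakStar_limit {α : Type*} (V : Ultrafilter α) {x : α → A} {C : ℝ}
    (hx : ∀ i, ‖x i‖ ≤ C) :
    ∃ u : (A →L[ℂ] ℂ) →L[ℂ] ℂ, ∀ χ, Tendsto (fun i => χ (x i)) V (𝓝 (u χ)) := by
  have hc := WeakDual.isCompact_closedBall (𝕜 := ℂ) (E := A →L[ℂ] ℂ) 0 C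
  obtain ⟨u, -, hu⟩ := isCompact_iff_ultrafilter_le_nhds'.1 hc
    (V.map fun i => StrongDual.toWeakDual (ιA A (x i)))
    (Ultrafilter.mem_map.2 (Filter.univ_mem' fun i => by simpa [norm_ιA] using hx i))
  refine ⟨WeakDual.toStrongDual u, fun χ => ?_⟩
  exact ((WeakDual.eval_continuous χ).tendsto u).comp (show Tendsto _ _ _ from hu)

/-- For weakly almost periodic `φ` and bounded `x`, the family `x i · φ` converges weakly along
ultrafilters. -/
lemma exists_weak_limit_of_mem_WAPset {α : Type*} (V : Ultrafilter α) {x : α → A} {C : ℝ}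
    (hx : ∀ i, ‖x i‖ ≤ C) {φ : A →L[ℂ] ℂ} (hφ : φ ∈ WAPset A) :
    ∃ η : A →L[ℂ] ℂ, ∀ u : (A →L[ℂ] ℂ) →L[ℂ] ℂ,
      Tendsto (fun i => u (dArL A (x i) φ)) V (𝓝 (u η)) := by
  obtain ⟨D, hD, hxD⟩ : ∃ D : ℝ, 0 < D ∧ ∀ i, ‖x i‖ ≤ D :=
    ⟨max C 1, by positivity, fun i => (hx i).trans (le_max_left _ _)⟩
  have hD' : (D : ℂ) ≠ 0 := by exact_mod_cast hD.ne'
  obtain ⟨η, -, hη⟩ := isCompact_iff_ultrafilter_le_nhds'.1 hφ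
    (V.map fun i => (show WeakSpace ℂ (A →L[ℂ] ℂ) from dArL A ((D : ℂ)⁻¹ • x i) φ))
    (Ultrafilter.mem_map.2 <| Filter.univ_mem' fun i => subset_closure ⟨(D : ℂ)⁻¹ • x i, by
      simp only [Metric.mem_closedBall, dist_zero_right, norm_smul, norm_inv, Complex.norm_real,
        Real.norm_eq_abs, abs_of_pos hD]
      rw [inv_mul_le_iff₀ hD, mul_one]
      exact hxD i, rfl⟩)
  refine ⟨(D : ℂ) • (show A →L[ℂ] ℂ from η), fun u => ?_⟩
  have hcont : Continuous fun χ : WeakSpace ℂ (A →L[ℂ] ℂ) => u χ :=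
    WeakBilin.eval_continuous _ u
  have h1 := ((hcont.tendsto η).comp (show Tendsto _ _ _ from hη)).const_mul (D : ℂ)
  rw [map_smul, smul_eq_mul]
  refine h1.congr fun i => ?_
  have h2 : dArL A (x i) φ = (D : ℂ) • dArL A ((D : ℂ)⁻¹ • x i) φ := by
    ext b
    simp [dArL_apply, mul_smul_comm, hD']
  change (D : ℂ) * u (dArL A ((D : ℂ)⁻¹ • x i) φ) = u (dArL A (x i) φ)
  rw [h2, map_smul, smul_eq_mul]

lemma exists_bound_of_ar1 {α : Type*} {e x : α → A} {C : ℝ} (he : ∀ i, ‖e i‖ ≤ C)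
    {m : (A →L[ℂ] ℂ) →L[ℂ] ℂ} (hx : ∀ i, ιA A (x i) = ar1 A (ιA A (e i)) m) :
    ∃ D, ∀ i, ‖x i‖ ≤ D := by
  refine ⟨‖m‖ * max C 0, fun i => ?_⟩
  rw [← norm_ιA, hx]
  refine ContinuousLinearMap.opNorm_le_bound _ (by positivity) fun φ => ?_
  have hφ : ‖dArR A φ (e i)‖ ≤ ‖φ‖ * max C 0 :=
    ContinuousLinearMap.opNorm_le_bound _ (by positivity) fun b => by
      rw [dArR_apply, mul_assoc]
      refine (φ.le_opNorm _).trans ?_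
      gcongr
      refine (norm_mul_le _ _).trans ?_
      gcongr
      exact (he i).trans (le_max_left _ _)
  calc ‖m (dArR A φ (e i))‖ ≤ ‖m‖ * (‖φ‖ * max C 0) := by
        refine (m.le_opNorm _).trans ?_
        gcongr
    _ = ‖m‖ * max C 0 * ‖φ‖ := by ring

/-- The weak*-convergence `eᵢ m n → u m n` for `m, n ∈ J**`, when `J` is a weak Riesz ideal,
`eᵢ` is a bounded right approximate identity for a set `S`, and `u` is determined by `S`. -/
lemma tendsto_ar1_ar1_of_weakRiesz {J : Submodule ℂ A} (hJ : IsClosedIdeal A J)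
    (hA : IdealInBidual A) (hwr : WeakRiesz A J) {α : Type*} {l : Filter α} {e : α → A} {C : ℝ}
    (he : ∀ i, ‖e i‖ ≤ C) {S : Set A} (heS : ∀ b ∈ S, Tendsto (fun i => b * e i) l (𝓝 b))
    {u : (A →L[ℂ] ℂ) →L[ℂ] ℂ} (hue : ∀ i φ, u (dArL A (e i) φ) = φ (e i))
    (huS : ∀ η : A →L[ℂ] ℂ, (∀ b ∈ S, η b = 0) → u η = 0)
    {m n : (A →L[ℂ] ℂ) →L[ℂ] ℂ} (hm : m ∈ bidualOf A J) (hn : n ∈ bidualOf A J)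
    (ψ : A →L[ℂ] ℂ) :
    Tendsto (fun i => ar1 A (ιA A (e i)) (ar1 A m n) ψ) l (𝓝 (ar1 A u (ar1 A m n) ψ)) := by
  rw [tendsto_iff_ultrafilter]
  intro V hV
  obtain ⟨E, hE⟩ := exists_weakStar_limit V he
  choose x hx using fun i => (hA m (e i)).2
  obtain ⟨D, hD⟩ := exists_bound_of_ar1 he hx
  have hxφ : ∀ i φ, φ (x i) = bdF A m φ (e i) := fun i φ => by
    rw [← ιA_apply, hx]; rfl
  have hperp : ar1 A E m - ar1 A u m ∈ wapPerp A J := by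
    refine ⟨fun φ hφ => ?_, fun φ hφ => ?_⟩
    · rw [sub_apply, ar1_mem_bidualOf hJ E hm φ hφ,
        ar1_mem_bidualOf hJ u hm φ hφ, sub_zero]
    obtain ⟨η, hη⟩ := exists_weak_limit_of_mem_WAPset V hD hφ
    have hxL : ∀ i, dArL A (x i) φ = dArL A (e i) (bdF A m φ) := fun i => by
      ext b
      have := hxφ i (dArR A φ b)
      rw [dArL_apply, dArL_apply, ← dArR_apply, this, bdF_apply, bdF_apply]
      congr 1
      ext c
      simp [dArR_apply, mul_assoc]
    have h1 : u η = u (bdF A m φ) := by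
      rw [← sub_eq_zero, ← map_sub]
      refine huS _ fun b hb => ?_
      rw [sub_apply, sub_eq_zero]
      refine tendsto_nhds_unique (hη (ιA A b)) ?_
      refine (((bdF A m φ).continuous.tendsto b).comp ((heS b hb).mono_left hV)).congr fun i => ?_
      rw [hxL]; rfl
    have h2 : Tendsto (fun i => bdF A m φ (e i)) V (𝓝 (u (bdF A m φ))) := by
      rw [← h1]
      refine (hη u).congr fun i => ?_
      rw [hxL, hue]
    rw [sub_apply, sub_eq_zero]
    exact tendsto_nhds_unique (hE _) h2
  have h0 := apply_eq_zero_of_mem_wapPerp hperp (hwr n hn ψ).1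
  rw [sub_apply, sub_eq_zero] at h0
  have hassoc : ∀ w, ar1 A w (ar1 A m n) ψ = ar1 A w m (bdF A n ψ) := fun w => by
    rw [ar1_apply, ar1_apply]
    congr 1
    ext a
    rw [bdF_apply, bdF_apply, ar1_apply]
    congr 1
    ext b
    rw [bdF_apply, dArR_apply, bdF_apply]
    congr 1
    ext c
    simp [dArR_apply, mul_assoc]
  simp only [hassoc]
  rw [← h0]
  exact hE _

/-- Recursive choice of a sequence whose `k`-th term satisfies an eventual property depending on
`k` and on the set of all earlier terms. -/
lemma exists_seq_of_eventually {α : Type*} [DecidableEq α] {l : Filter α} [l.NeBot]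
    {P : ℕ → Finset α → α → Prop} (hP : ∀ k s, ∀ᶠ i in l, P k s i) :
    ∃ σ : ℕ → α, ∀ k, P k ((Finset.range k).image σ) (σ k) := by
  choose f hf using fun k s => (hP k s).exists
  let T : ℕ → Finset α := fun k => Nat.rec ∅ (fun k s => insert (f k s) s) k
  refine ⟨fun k => f k (T k), fun k => ?_⟩
  have hT : ∀ k, (Finset.range k).image (fun k => f k (T k)) = T k := by
    intro k
    induction k with
    | zero => rfl
    | succ k ih => rw [Finset.range_add_one, Finset.image_insert, ih]
  rw [hT]
  exact hf k _

/-- A point of `A**` at positive distance from `A` is uniformly separated from a compact subset of `A`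
by finitely many functionals in the unit ball. -/
lemma exists_finset_separating {ξ : (A →L[ℂ] ℂ) →L[ℂ] ℂ} {d : ℝ}
    (hd : ∀ c, d < ‖ξ - ιA A c‖) {K : Set A} (hK : IsCompact K) :
    ∃ F : Finset (A →L[ℂ] ℂ), (∀ f ∈ F, ‖f‖ ≤ 1) ∧ ∀ c ∈ K, ∃ f ∈ F, d < ‖ξ f - f c‖ := by
  classical
  choose g hg1 hg using fun c => (ξ - ιA A c).exists_lt_apply_of_lt_opNorm (hd c)
  obtain ⟨t, -, ht⟩ := hK.elim_nhds_subcover (fun c => {b | d < ‖ξ (g c) - g c b‖}) fun c _ =>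
    (isOpen_lt continuous_const (by fun_prop)).mem_nhds (hg c)
  refine ⟨t.image g, fun f hf => ?_, fun c hc => ?_⟩
  · obtain ⟨c, -, rfl⟩ := Finset.mem_image.1 hf
    exact (hg1 c).le
  · obtain ⟨b, hb, hcb⟩ := Set.mem_iUnion₂.1 (ht hc)
    exact ⟨g b, Finset.mem_image_of_mem g hb, hcb⟩

/-- A weak limit of a sequence lies in every closed convex set containing the sequence. -/
lemma mem_closure_of_tendsto_weak {s : Set A} (hs : Convex ℝ s) {x : ℕ → A}
    (hx : ∀ k, x k ∈ s) {a : A} (ha : ∀ ψ : A →L[ℂ] ℂ, Tendsto (fun k => ψ (x k)) atTop (𝓝 (ψ a))) :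
    a ∈ closure s := by
  by_contra h
  obtain ⟨f, r, hf, hr⟩ :=
    RCLike.geometric_hahn_banach_closed_point (𝕜 := ℂ) hs.closure isClosed_closure h
  have h1 := (Complex.continuous_re.tendsto _).comp (ha f)
  exact absurd (le_of_tendsto' h1 fun k => (hf _ (subset_closure (hx k))).le) (not_le.2 hr)

/-- If `y i → ξ` weak* along `l` with `ξ ∈ A** \ A`, then there is a sequence among the `y i`,
as sparse as desired, with no weak limit in `A`. -/
lemma exists_seq_forall_not_tendsto_weak [CompleteSpace A] {α : Type*} {l : Filter α} [l.NeBot]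
    {y : α → A} {ξ : (A →L[ℂ] ℂ) →L[ℂ] ℂ} (hξ : ξ ∉ Set.range (ιA A))
    (hy : ∀ ψ : A →L[ℂ] ℂ, Tendsto (fun i => ψ (y i)) l (𝓝 (ξ ψ)))
    {R : ℕ → α → α → Prop} (hR : ∀ k j, ∀ᶠ i in l, R k j i) :
    ∃ σ : ℕ → α, (∀ j k, j < k → R k (σ j) (σ k)) ∧
      ∀ a, ¬ ∀ ψ : A →L[ℂ] ℂ, Tendsto (fun k => ψ (y (σ k))) atTop (𝓝 (ψ a)) := by
  classical
  obtain ⟨d, hd0, hd⟩ : ∃ d > 0, ∀ c, d < ‖ξ - ιA A c‖ := by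
    have hcl : IsClosed (Set.range (ιA A)) :=
      (NormedSpace.inclusionInDoubleDualLi (E := A)
        ℂ).isometry.isUniformInducing.isComplete_range.isClosed
    by_contra! hd
    refine hξ (hcl.closure_subset ?_)
    refine (SeminormedAddCommGroup.mem_closure_iff (E := (A →L[ℂ] ℂ) →L[ℂ] ℂ)).2 fun ε hε => ?_
    obtain ⟨c, hc⟩ := hd (ε / 2) (half_pos hε)
    exact ⟨_, ⟨c, rfl⟩, hc.trans_lt (half_lt_self hε)⟩
  choose F hF1 hF using fun T : Finset α => exists_finset_separating hd
    ((T.finite_toSet.image y).isCompact_convexHull ℝ)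
  obtain ⟨σ, hσ⟩ := exists_seq_of_eventually (l := l)
    (P := fun k s i => (∀ j ∈ s, R k j i) ∧
      ∀ T ∈ s.powerset, ∀ f ∈ F T, ‖f (y i) - ξ f‖ < 1 / ((k : ℝ) + 1)) fun k s => by
      refine ((Finset.eventually_all s).2 fun j _ => hR k j).and ?_
      refine (Finset.eventually_all _).2 fun T _ => (Finset.eventually_all _).2 fun f _ => ?_
      have := (hy f).sub_const (ξ f)
      rw [sub_self] at this
      exact this.norm.eventually_lt_const (by rw [norm_zero]; positivity)
  refine ⟨σ, fun j k hjk =>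
    (hσ k).1 _ (Finset.mem_image_of_mem σ (Finset.mem_range.2 hjk)), fun a ha => ?_⟩
  let T : ℕ → Finset α := fun k => (Finset.range k).image σ
  have hTmono : Monotone T := fun j k hjk =>
    Finset.image_subset_image (Finset.range_subset_range.2 hjk)
  have hconv : Convex ℝ (⋃ k, convexHull ℝ (y '' (T k : Set α))) := by
    refine Directed.convex_iUnion ?_ fun _ => convex_convexHull ℝ _
    exact (show Monotone fun k => convexHull ℝ (y '' (T k : Set α)) from fun j k hjk =>
      convexHull_mono (Set.image_mono (Finset.coe_subset.2 (hTmono hjk)))).directed_le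
  have hmem := mem_closure_of_tendsto_weak hconv (x := fun k => y (σ k)) (fun k =>
    Set.mem_iUnion.2 ⟨k + 1, subset_convexHull ℝ _ ⟨σ k, Finset.mem_coe.2
      (Finset.mem_image_of_mem σ (Finset.mem_range.2 k.lt_succ_self)), rfl⟩⟩) ha
  obtain ⟨c, hc, hac⟩ := Metric.mem_closure_iff.1 hmem d hd0
  obtain ⟨N, hcN⟩ := Set.mem_iUnion.1 hc
  obtain ⟨f, hf, hdf⟩ := hF (T N) c hcN
  have hlim : ξ f = f a := by
    refine tendsto_nhds_unique ?_ (ha f)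
    rw [tendsto_iff_norm_sub_tendsto_zero]
    refine squeeze_zero' (Eventually.of_forall fun _ => norm_nonneg _) ?_
      tendsto_one_div_add_atTop_nhds_zero_nat
    filter_upwards [eventually_ge_atTop N] with k hk
    exact ((hσ k).2 (T N) (Finset.mem_powerset.2 (hTmono hk)) f hf).le
  rw [hlim, ← map_sub] at hdf
  have := f.le_of_opNorm_le (hF1 _ f hf) (a - c)
  rw [dist_eq_norm] at hac
  linarith

end WeakRieszSmall

/-- Let `A` be a Banach algebra in the wsaBAI class and let `J` be a
closed ideal of `A`.  If `J` is a weak Riesz ideal, then `J` is a small-1-1 ideal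
(for any mixed identity `e` of `A**`). -/
theorem statement3 (A : Type*) [NonUnitalNormedRing A] [NormedSpace ℂ A]
    [IsScalarTower ℂ A A] [SMulCommClass ℂ A A] [CompleteSpace A]
    (h : IsWSABAI A) (J : Submodule ℂ A) (hJ : IsClosedIdeal A J)
    (e : (A →L[ℂ] ℂ) →L[ℂ] ℂ) (he : IsMixedIdentity A e)
    (hwr : WeakRiesz A J) :
    Small11 A J e := by
  intro m hm n hn
  obtain ⟨hwsc, ⟨α, l, v, hl, hbd, hvR, hvL⟩, hA⟩ := h
  obtain ⟨C, hC⟩ := hbd.exists_norm_le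
  have hvC : ∀ i, ‖v i‖ ≤ C := fun i => hC _ ⟨i, rfl⟩
  choose y hy using fun i => (hA (ar1 A m n) (v i)).2
  have hyψ : ∀ i ψ, ψ (y i) = ar1 A (ιA A (v i)) (ar1 A m n) ψ := fun i ψ => by
    rw [← hy, ιA_apply]
  set ξ := ar1 A e (ar1 A m n) with hξ
  have hlim : ∀ ψ : A →L[ℂ] ℂ, Tendsto (fun i => ψ (y i)) l (𝓝 (ξ ψ)) := fun ψ => by
    simp only [hyψ]
    refine tendsto_ar1_ar1_of_weakRiesz hJ hA hwr hvC (S := Set.univ) (fun b _ => hvR b)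
      (fun i φ => ?_) (fun η hη => ?_) hm hn ψ
    · exact DFunLike.congr_fun (he.2 (ιA A (v i))) φ
    · rw [show η = 0 from ContinuousLinearMap.ext fun b => hη b trivial, map_zero]
  suffices hmem : ξ ∈ Set.range (ιA A) by
    obtain ⟨a, ha⟩ := hmem
    refine ⟨a, mem_of_ιA_mem_bidualOf hJ.1 ?_, ha⟩
    rw [ha]
    exact ar1_mem_bidualOf hJ e (ar1_mem_bidualOf hJ m hn)
  by_contra hnot
  obtain ⟨σ, hσ, hσlim⟩ := exists_seq_forall_not_tendsto_weak hnot hlim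
    (R := fun k j i => ‖v j * v i - v j‖ < 1 / ((k : ℝ) + 1) ∧
      ‖v i * v j - v j‖ < 1 / ((k : ℝ) + 1)) fun k j => by
      have hpos : ‖(0 : A)‖ < 1 / ((k : ℝ) + 1) := by rw [norm_zero]; positivity
      have h1 := (hvR (v j)).sub_const (v j)
      have h2 := (hvL (v j)).sub_const (v j)
      rw [sub_self] at h1 h2
      exact (h1.norm.eventually_lt_const hpos).and (h2.norm.eventually_lt_const hpos)
  have hseq : ∀ {z : ℕ → A} {j : ℕ},
      (∀ k, j < k → ‖z k - v (σ j)‖ < 1 / ((k : ℝ) + 1)) → Tendsto z atTop (𝓝 (v (σ j))) := by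
    intro z j hz
    rw [tendsto_iff_norm_sub_tendsto_zero]
    refine squeeze_zero' (Eventually.of_forall fun _ => norm_nonneg _) ?_
      tendsto_one_div_add_atTop_nhds_zero_nat
    filter_upwards [eventually_gt_atTop j] with k hk using (hz k hk).le
  obtain ⟨u, hu⟩ := exists_weakStar_limit (hyperfilter ℕ) fun k => hvC (σ k)
  have hU : ((hyperfilter ℕ : Ultrafilter ℕ) : Filter ℕ) ≤ atTop := Nat.hyperfilter_le_atTop
  obtain ⟨a, ha⟩ := hwsc (fun k => y (σ k)) fun ψ => ⟨ar1 A u (ar1 A m n) ψ, by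
    simp only [hyψ]
    refine tendsto_ar1_ar1_of_weakRiesz hJ hA hwr (fun k => hvC (σ k))
      (S := Set.range fun k => v (σ k)) ?_ (fun j φ => ?_) (fun η hη => ?_) hm hn ψ
    · rintro _ ⟨j, rfl⟩
      exact hseq fun k hk => (hσ j k hk).1
    · refine tendsto_nhds_unique (hu _) ?_
      exact ((φ.continuous.tendsto _).comp (hseq fun k hk => (hσ j k hk).2)).mono_left hU
    · refine tendsto_nhds_unique (hu η) ?_
      simp only [hη _ ⟨_, rfl⟩]
      exact tendsto_const_nhds⟩
  exact hσlim a ha
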